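/- arXiv:1506.05701 — 3 statements merged into one kernel-verified Lean document; each statement's English description precedes it below -/
import Mathlib

section
/- Let n ≥ 1 and let A be an n×n integer matrix such that for every index i, the diagonal entry satisfies a_{ii} ≥ max(2, ∑_{j≠i} |a_{ij}|). If det(A) ≠ 0, then det(A) ≥ 2. -/
open Finset in
/-- A real matrix with weakly dominant nonnegative diagonal has nonnegative determinant. -/
theorem Matrix.det_nonneg_of_sum_abs_le_two_mul_diag {ι : Type*} [Fintype ι] [DecidableEq ι]
    (A : Matrix ι ι ℝ) (hA : ∀ i, ∑ j, |A i j| ≤ 2 * A i i) : 0 ≤ A.det := by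
  by_contra! hneg
  let f : ℝ → ℝ := fun s => (s • A + (1 - s) • (1 : Matrix ι ι ℝ)).det
  have hf : Continuous f := by
    apply Continuous.matrix_det
    fun_prop
  have h0 : f 0 = 1 := by simp [f]
  have h1 : f 1 = A.det := by simp [f]
  obtain ⟨s, ⟨hs0, hs1⟩, hs⟩ : (0 : ℝ) ∈ Set.image f (Set.Icc 0 1) :=
    intermediate_value_Icc' zero_le_one hf.continuousOn ⟨by rw [h1]; exact hneg.le, by simp [h0]⟩
  have hs1' : s < 1 := lt_of_le_of_ne hs1 (by rintro rfl; rw [h1] at hs; exact hneg.ne hs)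
  refine det_ne_zero_of_sum_row_lt_diag (A := s • A + (1 - s) • (1 : Matrix ι ι ℝ)) ?_ hs
  intro k
  have hk : |A k k| + ∑ j ∈ univ.erase k, |A k j| ≤ 2 * A k k := by
    rw [add_sum_erase univ (fun j => |A k j|) (mem_univ k)]
    exact hA k
  have hle := le_abs_self (A k k)
  have hoff : ∑ j ∈ univ.erase k, ‖(s • A + (1 - s) • (1 : Matrix ι ι ℝ)) k j‖
      = s * ∑ j ∈ univ.erase k, |A k j| := by
    rw [mul_sum]
    refine sum_congr rfl fun j hj => ?_
    simp [Matrix.one_apply_ne (ne_of_mem_erase hj).symm, abs_of_nonneg hs0]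
  have hdiag : (s • A + (1 - s) • (1 : Matrix ι ι ℝ)) k k = s * A k k + (1 - s) := by simp
  rw [hoff, hdiag, Real.norm_eq_abs]
  refine lt_of_lt_of_le ?_ (le_abs_self _)
  nlinarith [mul_le_mul_of_nonneg_left (show ∑ j ∈ univ.erase k, |A k j| ≤ A k k by linarith) hs0]

/-- An integer matrix with weakly dominant nonnegative diagonal has nonnegative determinant. -/
theorem Matrix.det_nonneg_of_sum_abs_le_two_mul_diag_int {ι : Type*} [Fintype ι] [DecidableEq ι]
    (A : Matrix ι ι ℤ) (hA : ∀ i, ∑ j, |A i j| ≤ 2 * A i i) : 0 ≤ A.det := by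
  have h := Matrix.det_nonneg_of_sum_abs_le_two_mul_diag (A.map (Int.castRingHom ℝ))
    (fun i => by simpa using (by exact_mod_cast hA i : (∑ j, |(A i j : ℝ)|) ≤ 2 * (A i i : ℝ)))
  rw [← RingHom.mapMatrix_apply, ← RingHom.map_det] at h
  simpa using h

/-- In each column of the adjugate of a matrix with weakly dominant diagonal, the diagonal entry
has the largest absolute value. -/
theorem Matrix.abs_adjugate_le_of_sum_abs_le_two_mul_diag {ι : Type*} [Fintype ι] [DecidableEq ι]
    (A : Matrix ι ι ℤ) (hA : ∀ i, ∑ j, |A i j| ≤ 2 * A i i) (j k : ι) :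
    |A.adjugate j k| ≤ A.adjugate k k := by
  have key : ∀ c : ℤ, |c| ≤ 1 → j ≠ k → 0 ≤ A.adjugate k k + c * A.adjugate j k := by
    intro c hc hjk
    have hdet : (A.updateRow k (Pi.single k 1 + c • Pi.single j 1)).det
        = A.adjugate k k + c * A.adjugate j k := by
      rw [Matrix.det_updateRow_add, Matrix.det_updateRow_smul, Matrix.adjugate_apply,
        Matrix.adjugate_apply]
    rw [← hdet]
    apply Matrix.det_nonneg_of_sum_abs_le_two_mul_diag_int
    intro i
    rcases eq_or_ne i k with rfl | hik
    · simp only [Matrix.updateRow_self]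
      calc ∑ l, |(Pi.single i 1 + c • Pi.single j 1 : ι → ℤ) l|
          ≤ ∑ l, ((Pi.single i 1 : ι → ℤ) l + |c| * (Pi.single j 1 : ι → ℤ) l) := by
            refine Finset.sum_le_sum fun l _ => ?_
            refine (abs_add_le _ _).trans (le_of_eq ?_)
            simp only [Pi.smul_apply, smul_eq_mul, abs_mul, Pi.single_apply]
            split_ifs <;> simp
        _ = 1 + |c| := by simp [Finset.sum_add_distrib, ← Finset.mul_sum]
        _ ≤ _ := by simp [hjk.symm]; linarith
    · simpa [Matrix.updateRow_ne hik] using hA i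
  have hdiag : 0 ≤ A.adjugate k k := by
    rw [Matrix.adjugate_apply]
    apply Matrix.det_nonneg_of_sum_abs_le_two_mul_diag_int
    intro i
    rcases eq_or_ne i k with rfl | hik
    · have : ∀ l, |(Pi.single i 1 : ι → ℤ) l| = (Pi.single i 1 : ι → ℤ) l := fun l => by
        simp only [Pi.single_apply]; split_ifs <;> simp
      simp [this]
    · simpa [Matrix.updateRow_ne hik] using hA i
  rcases eq_or_ne j k with rfl | hjk
  · exact (abs_of_nonneg hdiag).le
  · have h1 := key 1 (by simp) hjk
    have h2 := key (-1) (by simp) hjk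
    exact abs_le.2 ⟨by linarith, by linarith⟩

open scoped Matrix in
/-- If every row satisfies `∑ j, |A i j| = 2 * A i i`, then the determinant is not `1`, since it
is even. -/
theorem Matrix.det_ne_one_of_sum_abs_eq_two_mul_diag {ι : Type*} [Fintype ι] [DecidableEq ι]
    [Nonempty ι] (A : Matrix ι ι ℤ) (hA : ∀ i, ∑ j, |A i j| = 2 * A i i) : A.det ≠ 1 := by
  intro hdet
  have heven : ∀ i, ∃ c, (A *ᵥ 1) i = 2 * c := by
    intro i
    have h : (2 : ℤ) ∣ ∑ j, (|A i j| - A i j) := Finset.dvd_sum fun j _ => by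
      rcases abs_choice (A i j) with h | h <;> rw [h] <;> omega
    rw [Finset.sum_sub_distrib, hA i] at h
    have : (A *ᵥ 1) i = ∑ j, A i j := by simp [Matrix.mulVec, dotProduct]
    rw [this]
    obtain ⟨c, hc⟩ := h
    exact ⟨A i i - c, by linarith⟩
  choose v hv using heven
  have hv' : A *ᵥ 1 = (2 : ℤ) • v := funext fun i => by simpa using hv i
  have h := congrArg (A.adjugate *ᵥ ·) hv'
  simp only [Matrix.mulVec_mulVec, Matrix.adjugate_mul, hdet, one_smul, Matrix.one_mulVec,
    Matrix.mulVec_smul] at h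
  have hi := congrFun h (Classical.arbitrary ι)
  simp only [Pi.one_apply, Pi.smul_apply, smul_eq_mul] at hi
  omega

/-- A nonzero determinant of an integer matrix with weakly dominant diagonal and diagonal entries
at least `2` is at least `2`. -/
theorem Matrix.two_le_det_of_sum_abs_le_two_mul_diag (m : ℕ)
    (A : Matrix (Fin (m + 1)) (Fin (m + 1)) ℤ) (h2 : ∀ i, 2 ≤ A i i)
    (hA : ∀ i, ∑ j, |A i j| ≤ 2 * A i i) (hdet : A.det ≠ 0) : 2 ≤ A.det := by
  induction m with
  | zero => simpa using h2 0
  | succ m ih =>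
    have hnonneg := Matrix.det_nonneg_of_sum_abs_le_two_mul_diag_int A hA
    by_contra! hlt
    have hone : A.det = 1 := by omega
    refine Matrix.det_ne_one_of_sum_abs_eq_two_mul_diag A (fun k => ?_) hone
    have hadj := fun j => Matrix.abs_adjugate_le_of_sum_abs_le_two_mul_diag A hA j k
    have hrow : ∑ j, A k j * A.adjugate j k = 1 := by
      have := congrFun (congrFun A.mul_adjugate k) k
      simpa [Matrix.mul_apply, hone] using this
    have hne : A.adjugate k k ≠ 0 := by
      intro h0
      have hz : ∀ j, A.adjugate j k = 0 := fun j => abs_nonpos_iff.1 (h0 ▸ hadj j)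
      simp [hz] at hrow
    have hminor : A.adjugate k k = (A.submatrix k.succAbove k.succAbove).det := by
      rw [Matrix.adjugate_fin_succ_eq_det_submatrix, Even.neg_one_pow ⟨_, rfl⟩, one_mul]
    have hM : 2 ≤ A.adjugate k k := by
      rw [hminor]
      refine ih _ (fun i => h2 _) (fun i => ?_) (hminor ▸ hne)
      have := hA (k.succAbove i)
      rw [Fin.sum_univ_succAbove _ k] at this
      have := abs_nonneg (A (k.succAbove i) k)
      simp only [Matrix.submatrix_apply]
      linarith
    have hbound : (2 * A k k - ∑ j, |A k j|) * A.adjugate k k ≤ 1 := by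
      rw [Fin.sum_univ_succAbove _ k] at hrow ⊢
      have hoff : -((∑ i, |A k (k.succAbove i)|) * A.adjugate k k)
          ≤ ∑ i, A k (k.succAbove i) * A.adjugate (k.succAbove i) k := by
        rw [Finset.sum_mul, ← Finset.sum_neg_distrib]
        refine Finset.sum_le_sum fun i _ => (neg_le_neg ?_).trans (neg_abs_le _)
        rw [abs_mul]
        exact mul_le_mul_of_nonneg_left (hadj _) (abs_nonneg _)
      rw [abs_of_nonneg (by linarith [h2 k] : 0 ≤ A k k)]
      linarith
    have := hA k
    by_contra hneq
    have : 1 ≤ 2 * A k k - ∑ j, |A k j| := by omega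
    nlinarith

/-- Let `n ≥ 1` and let `A` be an `n × n` integer matrix such that for every index `i`,
the diagonal entry satisfies `A i i ≥ max 2 (∑ j ≠ i, |A i j|)`.
If `det A ≠ 0`, then `det A ≥ 2`. -/
theorem det_ge_two_of_diag_dominant (n : ℕ) (hn : 1 ≤ n)
    (A : Matrix (Fin n) (Fin n) ℤ)
    (hA : ∀ i, max 2 (∑ j ∈ Finset.univ.erase i, |A i j|) ≤ A i i)
    (hdet : A.det ≠ 0) :
    2 ≤ A.det := by
  obtain ⟨m, rfl⟩ := Nat.exists_eq_add_of_le' hn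
  refine Matrix.two_le_det_of_sum_abs_le_two_mul_diag m A
    (fun i => (le_max_left _ _).trans (hA i)) (fun i => ?_) hdet
  obtain ⟨h2, hsum⟩ := max_le_iff.1 (hA i)
  rw [← Finset.add_sum_erase Finset.univ (fun j => |A i j|) (Finset.mem_univ i),
    abs_of_nonneg (by linarith : 0 ≤ A i i)]
  linarith
end

section
/- Let n ≥ 1 and let A be an n×n integer matrix such that for every index i, the diagonal entry satisfies a_{ii} ≥ max(2, ∑_{j≠i} |a_{ij}|). Then det(A) is not a unit in ℤ; in particular det(A) ≠ 1 and det(A) ≠ -1, so A is not invertible over the integers. -/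
/-- An integer vector with entry `1` at `i` and at most one further nonzero entry, which is
then `1` or `-1`. -/
def IsElementaryDominant {ι : Type*} [Fintype ι] [DecidableEq ι] (i : ι) (w : ι → ℤ) : Prop :=
  w i = 1 ∧ ∑ j ∈ Finset.univ.erase i, |w j| ≤ 1

section

variable {ι : Type*} [Fintype ι] [DecidableEq ι]

/-- A vector dominated by its entry `k` at `i` is a sum of `k` elementary dominant vectors. -/
theorem exists_sum_isElementaryDominant (i : ι) (k : ℕ) (v : ι → ℤ) (hk : v i = k)
    (hv : ∑ j ∈ Finset.univ.erase i, |v j| ≤ v i) :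
    ∃ g : Fin k → ι → ℤ, (∀ t, IsElementaryDominant i (g t)) ∧ ∑ t, g t = v := by
  induction k generalizing v with
  | zero =>
    refine ⟨fun _ => 0, fun t => t.elim0, ?_⟩
    have hzero : ∀ j ∈ Finset.univ.erase i, |v j| = 0 :=
      (Finset.sum_eq_zero_iff_of_nonneg fun _ _ => abs_nonneg _).1
        (le_antisymm (by simpa [hk] using hv) (Finset.sum_nonneg fun _ _ => abs_nonneg _))
    ext j
    by_cases hj : j = i
    · simp [hj, hk]
    · simpa using (abs_eq_zero.1 (hzero j (by simp [hj]))).symm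
  | succ k ih =>
    obtain ⟨w, hw, hvw⟩ : ∃ w, IsElementaryDominant i w ∧
        ∑ j ∈ Finset.univ.erase i, |(v - w) j| ≤ k := by
      by_cases h : ∃ j, j ≠ i ∧ v j ≠ 0
      · obtain ⟨j, hj, hvj⟩ := h
        have hmem : j ∈ Finset.univ.erase i := by simp [hj]
        refine ⟨Pi.single i 1 + Pi.single j (v j).sign, ⟨by simp [hj.symm], ?_⟩, ?_⟩
        · rw [← Finset.add_sum_erase _ _ hmem, Finset.sum_eq_zero]
          · simp [hj, Int.abs_sign_of_ne_zero hvj]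
          · intro l hl
            simp only [Finset.mem_erase] at hl
            simp [hl.1, hl.2.1]
        · rw [← Finset.add_sum_erase _ _ hmem] at hv ⊢
          have hrest : ∑ l ∈ (Finset.univ.erase i).erase j,
              |(v - (Pi.single i 1 + Pi.single j (v j).sign) : ι → ℤ) l| =
              ∑ l ∈ (Finset.univ.erase i).erase j, |v l| := by
            refine Finset.sum_congr rfl fun l hl => ?_
            simp only [Finset.mem_erase] at hl
            simp [hl.1, hl.2.1]
          have habs : |v j - (v j).sign| = |v j| - 1 := by
            rcases lt_or_gt_of_ne hvj with hneg | hpos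
            · rw [Int.sign_eq_neg_one_of_neg hneg, abs_of_neg hneg, abs_of_nonpos (by lia)]
              ring
            · rw [Int.sign_eq_one_of_pos hpos, abs_of_pos hpos, abs_of_nonneg (by lia)]
          rw [hrest]
          simp only [Pi.sub_apply, Pi.add_apply, Pi.single_eq_same, Pi.single_eq_of_ne hj, zero_add,
            habs]
          push_cast at hk
          linarith
      · push Not at h
        refine ⟨Pi.single i 1, ⟨by simp, ?_⟩, ?_⟩
        · rw [Finset.sum_eq_zero]
          · simp
          · intro l hl
            simp [Finset.ne_of_mem_erase hl]
        · rw [Finset.sum_eq_zero]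
          · simp
          · intro l hl
            simp [Finset.ne_of_mem_erase hl, h l]
    have hi : (v - w) i = k := by simp [hk, hw.1]
    obtain ⟨g, hg, hsum⟩ := ih (v - w) hi (hvw.trans_eq hi.symm)
    refine ⟨Fin.cons w g, Fin.cases hw hg, ?_⟩
    simp [Fin.sum_univ_succ, hsum]

/-- A real matrix that is weakly row diagonally dominant with unit diagonal has nonnegative
determinant. -/
theorem Matrix.det_nonneg_of_sum_row_le_one (M : Matrix ι ι ℝ) (hdiag : ∀ i, M i i = 1)
    (hM : ∀ i, ∑ j ∈ Finset.univ.erase i, |M i j| ≤ 1) : 0 ≤ M.det := by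
  by_contra! hneg
  let f : ℝ → ℝ := fun s => ((1 - s) • (1 : Matrix ι ι ℝ) + s • M).det
  have hf : Continuous f := by
    apply Continuous.matrix_det
    fun_prop
  obtain ⟨s, ⟨hs0, hs1⟩, hs⟩ : (0 : ℝ) ∈ f '' Set.Ico 0 1 :=
    intermediate_value_Ico' zero_le_one hf.continuousOn
      ⟨by simpa [f] using hneg, by simp [f]⟩
  refine det_ne_zero_of_sum_row_lt_diag (fun i => ?_) hs
  have hoff : ∑ j ∈ Finset.univ.erase i, ‖((1 - s) • (1 : Matrix ι ι ℝ) + s • M) i j‖ =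
      s * ∑ j ∈ Finset.univ.erase i, |M i j| := by
    rw [Finset.mul_sum]
    refine Finset.sum_congr rfl fun j hj => ?_
    simp [Matrix.one_apply_ne (Finset.ne_of_mem_erase hj).symm, abs_of_nonneg hs0]
  rw [hoff]
  simpa [hdiag] using (mul_le_of_le_one_right hs0 (hM i)).trans_lt hs1

theorem Matrix.det_nonneg_of_isElementaryDominant (M : Matrix ι ι ℤ)
    (hM : ∀ i, IsElementaryDominant i (M i)) : 0 ≤ M.det := by
  have h := (M.map (Int.castRingHom ℝ)).det_nonneg_of_sum_row_le_one
    (fun i => by simp [(hM i).1]) (fun i => by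
      simp only [Matrix.map_apply, eq_intCast]
      exact_mod_cast (hM i).2)
  rw [← RingHom.mapMatrix_apply, ← RingHom.map_det] at h
  simpa using h

/-- If the determinant is odd, some column vanishes off the diagonal. -/
theorem Matrix.exists_column_eq_zero_of_odd_det [Nonempty ι] (M : Matrix ι ι ℤ)
    (hM : ∀ i, IsElementaryDominant i (M i)) (hdet : Odd M.det) :
    ∃ i, ∀ j, j ≠ i → M j i = 0 := by
  by_contra! hcol
  let N : ι → ι → ℤ := fun j i => if i = j then 0 else |M j i|
  have hNnonneg : ∀ j i, 0 ≤ N j i := fun j i => by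
    dsimp only [N]
    split_ifs <;> positivity
  have hNrow : ∀ j, ∑ i, N j i = ∑ i ∈ Finset.univ.erase j, |M j i| := fun j => by
    rw [← Finset.add_sum_erase _ _ (Finset.mem_univ j)]
    simp only [N, if_true, zero_add]
    exact Finset.sum_congr rfl fun i hi => if_neg (Finset.ne_of_mem_erase hi)
  have hNle : ∀ j ∈ Finset.univ, ∑ i, N j i ≤ 1 := fun j _ => (hNrow j).trans_le (hM j).2
  have hNcol : ∀ i, 1 ≤ ∑ j, N j i := fun i => by
    obtain ⟨j, hj, hji⟩ := hcol i
    refine le_trans ?_ (Finset.single_le_sum (fun j _ => hNnonneg j i) (Finset.mem_univ j))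
    simpa [N, hj.symm] using Int.one_le_abs hji
  have hNone : ∀ j ∈ Finset.univ, ∑ i, N j i = 1 := by
    refine (Finset.sum_eq_sum_iff_of_le hNle).1 (le_antisymm (Finset.sum_le_sum hNle) ?_)
    rw [Finset.sum_comm]
    exact Finset.sum_le_sum fun i _ => hNcol i
  have habs : ∀ x : ℤ, ((|x| : ℤ) : ZMod 2) = x := fun x => by
    rcases abs_choice x with h | h <;> simp [h, CharTwo.neg_eq]
  have hker : (M.map (Int.castRingHom (ZMod 2))).det = 0 := by
    refine Matrix.exists_mulVec_eq_zero_iff.1 ⟨1, one_ne_zero, ?_⟩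
    ext j
    have hj := congrArg (Int.cast : ℤ → ZMod 2) ((hNrow j).symm.trans (hNone j (Finset.mem_univ j)))
    push_cast [habs] at hj
    simp only [Matrix.mulVec, dotProduct, Matrix.map_apply, Pi.one_apply, mul_one, eq_intCast,
      Pi.zero_apply]
    rw [← Finset.add_sum_erase _ _ (Finset.mem_univ j), hj, (hM j).1]
    decide
  rw [← RingHom.mapMatrix_apply, ← RingHom.map_det, eq_intCast,
    ZMod.intCast_zmod_eq_zero_iff_dvd] at hker
  exact Int.not_even_iff_odd.2 hdet (even_iff_two_dvd.2 (by exact_mod_cast hker))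

/-- If column `i` vanishes off the diagonal, the determinant depends on row `i` only through
its diagonal entry. -/
theorem Matrix.det_updateRow_of_column_eq_zero (M : Matrix ι ι ℤ) (i : ι) (w : ι → ℤ)
    (hcol : ∀ j, j ≠ i → M j i = 0) (hw : w i = M i i) : (M.updateRow i w).det = M.det := by
  have hzero : (M.updateRow i (w - M i)).det = 0 := by
    refine Matrix.det_eq_zero_of_column_eq_zero i fun j => ?_
    by_cases hj : j = i
    · simp [hj, hw]
    · simp [hj, hcol j hj]
  have hadd := Matrix.det_updateRow_add M i (w - M i) (M i)
  rwa [sub_add_cancel, hzero, zero_add, Matrix.updateRow_eq_self] at hadd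

theorem Matrix.two_le_det_of_odd_det [Nonempty ι] (A : Matrix ι ι ℤ) (htwo : ∀ i, 2 ≤ A i i)
    (hA : ∀ i, ∑ j ∈ Finset.univ.erase i, |A i j| ≤ A i i) (hdet : Odd A.det) : 2 ≤ A.det := by
  have hcast : ∀ i, A i i = (A i i).toNat := fun i => (Int.toNat_of_nonneg (by grind)).symm
  choose g hg hsum using fun i =>
    exists_sum_isElementaryDominant i (A i i).toNat (A i) (hcast i) (hA i)
  let M : (∀ i, Fin (A i i).toNat) → Matrix ι ι ℤ := fun r => Matrix.of fun i => g i (r i)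
  have hexp : A.det = ∑ r, (M r).det := by
    have h := (Matrix.detRowAlternating (n := ι) (R := ℤ)).toMultilinearMap.map_sum g
    simp only [hsum] at h
    exact h
  have hnonneg : ∀ r, 0 ≤ (M r).det := fun r =>
    (M r).det_nonneg_of_isElementaryDominant fun i => hg i (r i)
  obtain ⟨r, hr⟩ : ∃ r, Odd (M r).det := by
    by_contra! h
    refine Int.not_even_iff_odd.2 hdet ?_
    rw [hexp]
    exact Finset.even_sum _ fun r _ => Int.not_odd_iff_even.1 (h r)
  obtain ⟨i, hi⟩ := (M r).exists_column_eq_zero_of_odd_det (fun i => hg i (r i)) hr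
  have : Nontrivial (Fin (A i i).toNat) := Fin.nontrivial_iff_two_le.2 (by grind)
  obtain ⟨t, ht⟩ := exists_ne (r i)
  have hupd : M (Function.update r i t) = (M r).updateRow i (g i t) := by
    ext j l
    by_cases hj : j = i
    · subst hj
      simp [M]
    · simp [M, hj]
  have hsame : (M (Function.update r i t)).det = (M r).det := by
    rw [hupd]
    exact (M r).det_updateRow_of_column_eq_zero i _ hi ((hg i t).1.trans (hg i (r i)).1.symm)
  have hne : Function.update r i t ≠ r := fun h => ht (by simpa using congrFun h i)
  have hpos : 1 ≤ (M r).det := (hnonneg r).lt_of_ne fun h => by simp [← h] at hr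
  calc 2 ≤ (M (Function.update r i t)).det + (M r).det := by lia
    _ ≤ ∑ r, (M r).det := Finset.add_le_sum (fun r _ => hnonneg r) (Finset.mem_univ _)
        (Finset.mem_univ _) hne
    _ = A.det := hexp.symm

end

/-- Let `n ≥ 1` and let `A` be an `n × n` integer matrix such that for every index `i`,
the diagonal entry satisfies `A i i ≥ max 2 (∑ j ≠ i, |A i j|)`. Then `det A` is not a
unit in `ℤ`; in particular `det A ≠ 1` and `det A ≠ -1`, so `A` is not invertible over
the integers. -/
theorem det_not_unit_of_diag_dominant (n : ℕ) (hn : 1 ≤ n)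
    (A : Matrix (Fin n) (Fin n) ℤ)
    (hA : ∀ i, max 2 (∑ j ∈ Finset.univ.erase i, |A i j|) ≤ A i i) :
    ¬ IsUnit A.det ∧ A.det ≠ 1 ∧ A.det ≠ -1 ∧ ¬ IsUnit A := by
  have : Nonempty (Fin n) := ⟨⟨0, hn⟩⟩
  have hdet : ¬ IsUnit A.det := fun h => by
    have hodd : Odd A.det := by
      rcases Int.isUnit_iff.1 h with h | h <;> rw [h] <;> decide
    have htwo := A.two_le_det_of_odd_det (fun i => (le_max_left _ _).trans (hA i))
      (fun i => (le_max_right _ _).trans (hA i)) hodd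
    rcases Int.isUnit_iff.1 h with h | h <;> lia
  exact ⟨hdet, fun h => hdet (by simp [h]), fun h => hdet (by simp [h]),
    fun h => hdet ((Matrix.isUnit_iff_isUnit_det A).1 h)⟩
end

section
/- For every n ≥ 1 there exists an n×n integer matrix A such that for every index i the diagonal entry satisfies a_{ii} ≥ max(2, ∑_{j≠i} |a_{ij}|), and det(A) = 2. Hence the lower bound det(A) ≥ 2 in the determinant theorem is sharp. -/
/-- The tridiagonal Cartan matrix of type `C`, whose double bond lies in the first row. -/
def doubleBondMatrix (n : ℕ) : Matrix (Fin n) (Fin n) ℤ := fun i j =>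
  if (j : ℕ) = i then 2
  else if (j : ℕ) = i + 1 then (if (i : ℕ) = 0 then -2 else -1)
  else if (i : ℕ) = j + 1 then -1
  else 0

theorem sum_ite_val_eq_le {n : ℕ} (s : Finset (Fin n)) (k : ℕ) {c : ℤ} (hc : 0 ≤ c) :
    ∑ j ∈ s, (if (j : ℕ) = k then c else 0) ≤ c := by
  by_cases hk : k < n
  · have h (j : Fin n) : (j : ℕ) = k ↔ j = ⟨k, hk⟩ := by simp [Fin.ext_iff]
    simp only [h, Finset.sum_ite_eq']
    split_ifs <;> omega
  · have h (j : Fin n) : (j : ℕ) ≠ k := by omega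
    simpa [h] using hc

theorem sum_abs_doubleBondMatrix_le (n : ℕ) (i : Fin n) :
    ∑ j ∈ Finset.univ.erase i, |doubleBondMatrix n i j| ≤ 2 := by
  have h₁ := sum_ite_val_eq_le (Finset.univ.erase i) (i + 1)
    (c := if (i : ℕ) = 0 then 2 else 1) (by split_ifs <;> norm_num)
  have h₂ := sum_ite_val_eq_le (Finset.univ.erase i) (i - 1)
    (c := if (i : ℕ) = 0 then 0 else 1) (by split_ifs <;> norm_num)
  calc
    _ ≤ ∑ j ∈ Finset.univ.erase i,
        ((if (j : ℕ) = i + 1 then (if (i : ℕ) = 0 then 2 else 1) else 0 : ℤ) +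
          (if (j : ℕ) = i - 1 then (if (i : ℕ) = 0 then 0 else 1) else 0)) := by
      refine Finset.sum_le_sum fun j hj => ?_
      have hji : (j : ℕ) ≠ i := fun h => Finset.ne_of_mem_erase hj (Fin.ext h)
      unfold doubleBondMatrix
      split_ifs <;> first | omega | norm_num
    _ ≤ 2 := by
      rw [Finset.sum_add_distrib]
      split_ifs at h₁ h₂ ⊢ <;> linarith

theorem det_doubleBondMatrix_succ (n : ℕ) : (doubleBondMatrix (n + 1)).det = 2 := by
  let L : Matrix (Fin (n + 1)) (Fin (n + 1)) ℤ := fun i j =>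
    if (j : ℕ) = i then (if (i : ℕ) = 0 then 2 else 1)
    else if (i : ℕ) = j + 1 then -1
    else 0
  have hL : L.det = (doubleBondMatrix (n + 1)).det := by
    refine Matrix.det_eq_of_forall_col_eq_smul_add_pred (fun _ => 1) (fun i => ?_)
      (fun i j => ?_)
    · simp only [L, doubleBondMatrix, Fin.val_zero]
      grind
    · simp only [L, doubleBondMatrix, Fin.val_succ, Fin.val_castSucc]
      split_ifs <;> omega
  rw [← hL, Matrix.det_of_isLowerTriangular L, Fin.prod_univ_succ]
  · simp [L]
  · intro i j hij
    have hij' : (i : ℕ) < j := hij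
    simp only [L]
    split_ifs <;> omega


/-- For every `n ≥ 1` there exists an `n × n` integer matrix `A` satisfying the
strengthened row diagonal dominance condition
`A i i ≥ max 2 (∑ j ≠ i, |A i j|)` for every `i`, with `det A = 2`.
Hence the lower bound `det A ≥ 2` in the determinant theorem is sharp. -/
theorem exists_diag_dominant_det_eq_two (n : ℕ) (hn : 1 ≤ n) :
    ∃ A : Matrix (Fin n) (Fin n) ℤ,
      (∀ i, max 2 (∑ j ∈ Finset.univ.erase i, |A i j|) ≤ A i i) ∧ A.det = 2 := by
  obtain ⟨m, rfl⟩ := Nat.exists_eq_add_of_le' hn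
  refine ⟨doubleBondMatrix (m + 1), fun i => ?_, det_doubleBondMatrix_succ m⟩
  have hi : doubleBondMatrix (m + 1) i i = 2 := by simp [doubleBondMatrix]
  rw [hi]
  exact max_le le_rfl (sum_abs_doubleBondMatrix_le (m + 1) i)
end
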